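/- arXiv:2406.17365 — 2 statements merged into one kernel-verified Lean document; each statement's English description precedes it below -/
import Mathlib

section
/- Let τ be a complex number with Re(τ) > 0, let s be a complex number with s ≠ 0, and let c be a real number with c > max(Re(s), 1). Then τ^{s/2}·∫_{1}^{∞} x^{s/2 - 1}·ψ(τx) dx = (τ^{s/2}/(2π)) · ∫_{-∞}^{∞} Λ(c + it) · τ^{-(c+it)/2} / (c + it - s) dt, where Λ is the completed Riemann zeta function. -/
open MeasureTheory Complex Real

/-- For `Re z > 0`, `ψ z = ∑_{n ≥ 1} exp (-π n² z)`. -/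
noncomputable def psiC (z : ℂ) : ℂ := ∑' n : ℕ, Complex.exp (-(π : ℂ) * ((n : ℂ) + 1) ^ 2 * z)

theorem integrableOn_rpow_mul_exp_neg_mul {p b : ℝ} (hp : -1 < p) (hb : 0 < b) :
    IntegrableOn (fun t : ℝ => t ^ p * rexp (-(b * t))) (Set.Ioi 0) := by
  simpa using integrableOn_rpow_mul_exp_neg_mul_rpow hp one_pos hb

theorem norm_cpow_mul_exp_neg_mul {t : ℝ} (ht : 0 < t) (a r : ℂ) :
    ‖(t : ℂ) ^ (a - 1) * cexp (-(r * t))‖ = t ^ (a.re - 1) * rexp (-(r.re * t)) := by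
  rw [norm_mul, norm_cpow_eq_rpow_re_of_pos ht, Complex.norm_exp]
  simp

theorem aestronglyMeasurable_cpow_mul_exp (a r : ℂ) :
    AEStronglyMeasurable (fun t : ℝ => (t : ℂ) ^ (a - 1) * cexp (-(r * t)))
      (volume.restrict (Set.Ioi 0)) := by
  refine ContinuousOn.aestronglyMeasurable (fun t ht => ?_) measurableSet_Ioi
  have : ContinuousAt (fun t : ℝ => (t : ℂ) ^ (a - 1)) t :=
    continuousAt_ofReal_cpow_const t _ (Or.inr (ne_of_gt ht))
  exact (this.mul (by fun_prop)).continuousWithinAt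

theorem integrableOn_cpow_mul_exp_neg_mul {a r : ℂ} (ha : 0 < a.re) (hr : 0 < r.re) :
    IntegrableOn (fun t : ℝ => (t : ℂ) ^ (a - 1) * cexp (-(r * t))) (Set.Ioi 0) := by
  refine (integrableOn_rpow_mul_exp_neg_mul (p := a.re - 1) (by linarith) hr).mono'
    (aestronglyMeasurable_cpow_mul_exp a r) ?_
  filter_upwards [ae_restrict_mem measurableSet_Ioi] with t ht
  exact (norm_cpow_mul_exp_neg_mul ht a r).le

theorem differentiableAt_integral_cpow_mul_exp_neg_mul {a r : ℂ} (ha : 0 < a.re) (hr : 0 < r.re) :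
    DifferentiableAt ℂ
      (fun r : ℂ => ∫ t : ℝ in Set.Ioi 0, (t : ℂ) ^ (a - 1) * cexp (-(r * t))) r := by
  have hs : {z : ℂ | r.re / 2 < z.re} ∈ nhds r :=
    (isOpen_lt continuous_const continuous_re).mem_nhds (by simpa using hr)
  refine (hasDerivAt_integral_of_dominated_loc_of_deriv_le
    (F' := fun r t => (t : ℂ) ^ (a - 1) * cexp (-(r * t)) * (-t))
    (bound := fun t => t ^ a.re * rexp (-(r.re / 2 * t))) hs
    (Filter.Eventually.of_forall fun z => aestronglyMeasurable_cpow_mul_exp a z)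
    (integrableOn_cpow_mul_exp_neg_mul ha hr)
    ((aestronglyMeasurable_cpow_mul_exp a r).mul (by fun_prop)) ?_
    (integrableOn_rpow_mul_exp_neg_mul (by linarith) (by linarith)) ?_).2.differentiableAt
  · filter_upwards [ae_restrict_mem measurableSet_Ioi] with t ht z hz
    have ht : 0 < t := ht
    have hz : r.re / 2 < z.re := hz
    rw [norm_mul, norm_cpow_mul_exp_neg_mul ht, norm_neg, norm_real, Real.norm_of_nonneg ht.le,
      mul_right_comm, ← rpow_add_one ht.ne', sub_add_cancel]
    gcongr
  · refine Filter.Eventually.of_forall fun t z _ => ?_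
    have h : HasDerivAt (fun z : ℂ => -(z * t)) (-(t : ℂ)) z :=
      (hasDerivAt_mul_const (t : ℂ)).fun_neg
    simpa [mul_assoc] using h.cexp.const_mul ((t : ℂ) ^ (a - 1))

/-- Euler's integral for the Gamma function with a complex scaling parameter of positive real
part. -/
theorem integral_cpow_mul_exp_neg_complex_mul_Ioi {a r : ℂ} (ha : 0 < a.re) (hr : 0 < r.re) :
    ∫ t : ℝ in Set.Ioi 0, (t : ℂ) ^ (a - 1) * cexp (-(r * t)) = r ^ (-a) * Complex.Gamma a := by
  have hU : IsOpen {z : ℂ | 0 < z.re} := isOpen_lt continuous_const continuous_re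
  have hf : AnalyticOnNhd ℂ
      (fun r : ℂ => ∫ t : ℝ in Set.Ioi 0, (t : ℂ) ^ (a - 1) * cexp (-(r * t))) {z | 0 < z.re} :=
    DifferentiableOn.analyticOnNhd (fun z hz =>
      (differentiableAt_integral_cpow_mul_exp_neg_mul ha hz).differentiableWithinAt) hU
  have hg : AnalyticOnNhd ℂ (fun r : ℂ => r ^ (-a) * Complex.Gamma a) {z | 0 < z.re} := by
    refine DifferentiableOn.analyticOnNhd (fun z hz => ?_) hU
    exact ((differentiableAt_id.cpow_const (Or.inl hz)).mul_const _).differentiableWithinAt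
  refine hf.eqOn_of_preconnected_of_frequently_eq hg (convex_halfSpace_re_gt 0).isPreconnected
    (z₀ := ((1 : ℝ) : ℂ)) (by simp) ?_ hr
  have ht : Filter.Tendsto (fun x : ℝ => (x : ℂ)) (nhdsWithin 1 {1}ᶜ)
      (nhdsWithin ((1 : ℝ) : ℂ) {((1 : ℝ) : ℂ)}ᶜ) :=
    continuous_ofReal.continuousAt.continuousWithinAt.tendsto_nhdsWithin
      (fun x hx => by simpa using hx)
  refine ht.frequently (Filter.Eventually.frequently ?_)
  filter_upwards [mem_nhdsWithin_of_mem_nhds (lt_mem_nhds one_pos)] with x hx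
  have hx : 0 < x := hx
  rw [Complex.integral_cpow_mul_exp_neg_mul_Ioi ha hx, one_div, cpow_neg, inv_cpow]
  rw [arg_ofReal_of_nonneg hx.le]
  exact pi_pos.ne

theorem norm_cpow_neg_mul_Gamma_le {a r : ℂ} (ha : 0 < a.re) (hr : 0 < r.re) :
    ‖r ^ (-a) * Complex.Gamma a‖ ≤ ∫ t : ℝ in Set.Ioi 0, t ^ (a.re - 1) * rexp (-(r.re * t)) := by
  rw [← integral_cpow_mul_exp_neg_complex_mul_Ioi ha hr]
  refine (norm_integral_le_integral_norm _).trans_eq ?_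
  exact setIntegral_congr_fun measurableSet_Ioi fun t ht => norm_cpow_mul_exp_neg_mul ht a r

/-- On vertical lines, the Gamma function decays faster than `exp (-θ |y|)` for all
`θ < π / 2`. -/
theorem exists_norm_Gamma_le {σ θ : ℝ} (hσ : 0 < σ) (hθ : |θ| < π / 2) :
    ∃ K : ℝ, ∀ y : ℝ, ‖Complex.Gamma (σ + y * I)‖ ≤ K * rexp (-(θ * |y|)) := by
  refine ⟨∫ t : ℝ in Set.Ioi 0, t ^ (σ - 1) * rexp (-(Real.cos θ * t)), fun y => ?_⟩
  have key (φ : ℝ) (hφ : |φ| < π / 2) : rexp (φ * y) * ‖Complex.Gamma (σ + y * I)‖ ≤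
      ∫ t : ℝ in Set.Ioi 0, t ^ (σ - 1) * rexp (-(Real.cos φ * t)) := by
    obtain ⟨h1, h2⟩ := abs_lt.mp hφ
    have hre : (cexp (φ * I)).re = Real.cos φ := exp_ofReal_mul_I_re φ
    have hcos : 0 < (cexp (φ * I)).re := hre ▸ cos_pos_of_mem_Ioo ⟨h1, h2⟩
    have h := norm_cpow_neg_mul_Gamma_le (a := σ + y * I) (by simpa using hσ) hcos
    rw [norm_mul, norm_cpow_of_ne_zero (Complex.exp_ne_zero _), norm_exp_ofReal_mul_I, hre,
      arg_exp_mul_I, (toIocMod_eq_self _).mpr ⟨by linarith, by linarith [pi_pos]⟩] at h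
    simpa [← Real.exp_neg] using h
  have h : rexp (θ * |y|) * ‖Complex.Gamma (σ + y * I)‖ ≤
      ∫ t : ℝ in Set.Ioi 0, t ^ (σ - 1) * rexp (-(Real.cos θ * t)) := by
    rcases abs_cases y with ⟨hy, -⟩ | ⟨hy, -⟩
    · simpa [hy] using key θ hθ
    · simpa [hy] using key (-θ) (by simpa using hθ)
  rw [Real.exp_neg, ← div_eq_mul_inv, le_div_iff₀ (Real.exp_pos _), mul_comm]
  exact h

theorem integrable_exp_neg_mul_abs {δ : ℝ} (hδ : 0 < δ) :
    Integrable fun y : ℝ => rexp (-(δ * |y|)) := by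
  refine (integrable_inv_one_add_sq.comp_mul_left' (R := δ / 2) (by positivity)).mono'
    (by fun_prop) (Filter.Eventually.of_forall fun y => ?_)
  have hy : 0 ≤ δ * |y| := by positivity
  rw [Real.norm_of_nonneg (Real.exp_pos _).le, Real.exp_neg]
  refine inv_anti₀ (by positivity) ?_
  have h := Real.quadratic_le_exp_of_nonneg hy
  have h' : (δ / 2 * y) ^ 2 = (δ * |y|) ^ 2 / 4 := by rw [mul_pow, mul_pow, sq_abs]; ring
  nlinarith [sq_nonneg (δ * |y|)]

theorem verticalIntegrable_Gamma_mul_cpow {σ : ℝ} {τ : ℂ} (hσ : 0 < σ) (hτ : 0 < τ.re) :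
    VerticalIntegrable (fun w => τ ^ (-w) * Complex.Gamma w) σ := by
  have hτ0 : τ ≠ 0 := by rintro rfl; simp at hτ
  have harg : |τ.arg| < π / 2 := abs_arg_lt_pi_div_two_iff.mpr (Or.inl hτ)
  obtain ⟨θ, hθ, hθ'⟩ := exists_between harg
  have hθ0 : 0 ≤ θ := (abs_nonneg _).trans hθ.le
  obtain ⟨K, hK⟩ := exists_norm_Gamma_le hσ (by rwa [abs_of_nonneg hθ0] : |θ| < π / 2)
  refine ((integrable_exp_neg_mul_abs (sub_pos.mpr hθ)).const_mul (‖τ‖ ^ (-σ) * K)).mono' ?_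
    (Filter.Eventually.of_forall fun y => ?_)
  · refine Continuous.aestronglyMeasurable (continuous_iff_continuousAt.mpr fun y => ?_)
    have hG : ContinuousAt Complex.Gamma (σ + y * I) := by
      refine (differentiableAt_Gamma _ fun m hm => ?_).continuousAt
      have := congrArg re hm
      simp at this
      linarith [(Nat.cast_nonneg m : (0 : ℝ) ≤ m)]
    have h1 : ContinuousAt (fun y : ℝ => Complex.Gamma (σ + y * I)) y :=
      ContinuousAt.comp (f := fun y : ℝ => (σ + y * I : ℂ)) hG (by fun_prop)
    have h2 : ContinuousAt (fun y : ℝ => τ ^ (-(σ + y * I : ℂ))) y :=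
      ContinuousAt.const_cpow (by fun_prop) (Or.inl hτ0)
    exact h2.mul h1
  · rw [norm_mul, norm_cpow_of_ne_zero hτ0]
    have hre : (-(σ + y * I : ℂ)).re = -σ := by simp
    have him : (-(σ + y * I : ℂ)).im = -y := by simp
    rw [hre, him, mul_neg, Real.exp_neg, div_inv_eq_mul]
    calc
      _ ≤ ‖τ‖ ^ (-σ) * rexp (|τ.arg| * |y|) * (K * rexp (-(θ * |y|))) := by
        gcongr _ * rexp ?_ * ?_
        · exact (le_abs_self _).trans_eq (abs_mul _ _)
        · exact hK y
      _ = ‖τ‖ ^ (-σ) * K * (rexp (|τ.arg| * |y|) * rexp (-(θ * |y|))) := by ring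
      _ = _ := by rw [← Real.exp_add]; ring_nf

/-- The Cahen–Mellin integral: `exp (-τ x)` as the inverse Mellin transform of `τ ^ (-w) Γ(w)`. -/
theorem mellinInv_cpow_neg_mul_Gamma {σ x : ℝ} {τ : ℂ} (hσ : 0 < σ) (hτ : 0 < τ.re) (hx : 0 < x) :
    mellinInv σ (fun w => τ ^ (-w) * Complex.Gamma w) x = cexp (-(τ * x)) := by
  have hm (y : ℝ) : mellin (fun t : ℝ => cexp (-(τ * t))) (σ + y * I) =
      τ ^ (-(σ + y * I : ℂ)) * Complex.Gamma (σ + y * I) :=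
    integral_cpow_mul_exp_neg_complex_mul_Ioi (by simpa using hσ) hτ
  rw [← mellinInv_mellin_eq σ (fun t : ℝ => cexp (-(τ * t))) hx
    (integrableOn_cpow_mul_exp_neg_mul (by simpa using hσ) hτ)
    ((verticalIntegrable_Gamma_mul_cpow hσ hτ).congr
      (Filter.Eventually.of_forall fun y => (hm y).symm)) (by fun_prop)]
  simp only [mellinInv, hm]

theorem integral_Ioi_one_cpow_mul_mellinInv {σ : ℝ} {a : ℂ} {f : ℂ → ℂ} (ha : a.re < σ)
    (hf : VerticalIntegrable f σ) :
    ∫ x in Set.Ioi (1 : ℝ), (x : ℂ) ^ (a - 1) * mellinInv σ f x =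
      1 / (2 * π) * ∫ y : ℝ, f (σ + y * I) / (σ + y * I - a) := by
  have hexp (y : ℝ) : (a - 1 - (σ + y * I)).re = a.re - 1 - σ := by simp
  have hswap : Integrable (Function.uncurry fun (x y : ℝ) =>
      (x : ℂ) ^ (a - 1 - (σ + y * I)) * f (σ + y * I))
      ((volume.restrict (Set.Ioi (1 : ℝ))).prod volume) := by
    have hr : IntegrableOn (fun x : ℝ => x ^ (a.re - 1 - σ)) (Set.Ioi 1) :=
      integrableOn_Ioi_rpow_of_lt (by linarith) one_pos
    refine (Integrable.mul_prod hr (Integrable.norm hf)).mono' ?_ ?_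
    · refine AEStronglyMeasurable.mul ?_ (Integrable.aestronglyMeasurable hf).comp_snd
      exact Measurable.aestronglyMeasurable (by fun_prop)
    · have hx : ∀ᵐ p : ℝ × ℝ ∂((volume.restrict (Set.Ioi (1 : ℝ))).prod volume), 1 < p.1 :=
        Measure.quasiMeasurePreserving_fst.ae (ae_restrict_mem measurableSet_Ioi)
      filter_upwards [hx] with p hp
      rw [Function.uncurry, norm_mul, norm_cpow_eq_rpow_re_of_pos (one_pos.trans hp), hexp]
  calc
    _ = ∫ x in Set.Ioi (1 : ℝ), 1 / (2 * π : ℂ) *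
          ∫ y : ℝ, (x : ℂ) ^ (a - 1 - (σ + y * I)) * f (σ + y * I) := by
      refine setIntegral_congr_fun measurableSet_Ioi fun x hx => ?_
      have hx0 : (x : ℂ) ≠ 0 := ofReal_ne_zero.mpr (one_pos.trans hx).ne'
      simp only [mellinInv, smul_eq_mul, real_smul]
      rw [mul_left_comm, ← integral_const_mul]
      push_cast
      simp_rw [sub_eq_add_neg (a - 1), cpow_add _ _ hx0, mul_assoc]
    _ = _ := by
      rw [integral_const_mul, integral_integral_swap hswap]
      congr 2 with y
      rw [integral_mul_const, integral_Ioi_cpow_of_lt (by rw [hexp]; linarith) one_pos, ofReal_one,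
        one_cpow, mul_comm, mul_div_assoc', mul_neg_one, ← neg_div_neg_eq, neg_neg]
      ring_nf

theorem completedRiemannZeta_eq_Gamma_mul_tsum {w : ℂ} (hw : 1 / 2 < w.re) :
    completedRiemannZeta (2 * w) =
      Complex.Gamma w * ∑' n : ℕ, ((π * ((n : ℝ) + 1) ^ 2 : ℝ) : ℂ) ^ (-w) := by
  have h1 : 1 < (2 * w).re := by simp; linarith
  rw [completedZeta_eq_tsum_of_one_lt_re h1, ← zeta_eq_tsum_one_div_nat_cpow h1,
    zeta_eq_tsum_one_div_nat_add_one_cpow h1, mul_comm (_ ^ _), mul_assoc, ← tsum_mul_left,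
    mul_div_cancel_left₀ _ two_ne_zero]
  congr 2 with n
  have hn : (0 : ℝ) ≤ (n : ℝ) + 1 := by positivity
  rw [ofReal_mul, mul_cpow_ofReal_nonneg pi_pos.le (by positivity), sq, ofReal_mul,
    mul_cpow_ofReal_nonneg hn hn, one_div, ← cpow_neg, ← cpow_add _ _ (by norm_cast)]
  push_cast
  ring_nf

theorem summable_pi_mul_sq_rpow {σ : ℝ} (hσ : 1 / 2 < σ) :
    Summable fun n : ℕ => (π * ((n : ℝ) + 1) ^ 2) ^ (-σ) := by
  have h : Summable fun n : ℕ => ((n + 1 : ℕ) : ℝ) ^ (-(2 * σ)) :=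
    (summable_nat_add_iff 1).mpr (Real.summable_nat_rpow.mpr (by linarith))
  refine (h.mul_left (π ^ (-σ))).congr fun n => ?_
  rw [Real.mul_rpow pi_pos.le (by positivity), ← Real.rpow_natCast_mul (by positivity)]
  push_cast
  ring_nf

theorem norm_pi_mul_sq_cpow {σ : ℝ} (n : ℕ) (y : ℝ) :
    ‖((π * ((n : ℝ) + 1) ^ 2 : ℝ) : ℂ) ^ (-(σ + y * I : ℂ))‖ = (π * ((n : ℝ) + 1) ^ 2) ^ (-σ) := by
  rw [norm_cpow_eq_rpow_re_of_pos (by positivity)]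
  simp

theorem verticalIntegrable_cpow_mul_completedRiemannZeta {σ : ℝ} {τ : ℂ} (hσ : 1 / 2 < σ)
    (hτ : 0 < τ.re) :
    VerticalIntegrable (fun w => τ ^ (-w) * completedRiemannZeta (2 * w)) σ := by
  have hτ0 : τ ≠ 0 := by rintro rfl; simp at hτ
  refine (Integrable.mul_const (Integrable.norm (verticalIntegrable_Gamma_mul_cpow
    (by linarith : 0 < σ) hτ)) (∑' n : ℕ, (π * ((n : ℝ) + 1) ^ 2) ^ (-σ))).mono' ?_
    (Filter.Eventually.of_forall fun y => ?_)
  · refine Continuous.aestronglyMeasurable (continuous_iff_continuousAt.mpr fun y => ?_)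
    have hre : (2 * (σ + y * I) : ℂ).re = 2 * σ := by simp
    have hΛ : ContinuousAt completedRiemannZeta (2 * (σ + y * I)) := by
      refine (differentiableAt_completedZeta (fun h => ?_) (fun h => ?_)).continuousAt <;>
      · rw [h] at hre
        simp at hre
        linarith
    have h1 : ContinuousAt (fun y : ℝ => completedRiemannZeta (2 * (σ + y * I))) y :=
      ContinuousAt.comp (f := fun y : ℝ => (2 * (σ + y * I) : ℂ)) hΛ (by fun_prop)
    have h2 : ContinuousAt (fun y : ℝ => τ ^ (-(σ + y * I : ℂ))) y :=
      ContinuousAt.const_cpow (by fun_prop) (Or.inl hτ0)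
    exact h2.mul h1
  · beta_reduce
    rw [completedRiemannZeta_eq_Gamma_mul_tsum (by simpa using hσ), ← mul_assoc, norm_mul]
    refine mul_le_mul_of_nonneg_left ?_ (norm_nonneg _)
    exact tsum_of_norm_bounded (summable_pi_mul_sq_rpow hσ).hasSum
      fun n => (norm_pi_mul_sq_cpow n y).le

theorem psiC_mul_eq_mellinInv {σ x : ℝ} {τ : ℂ} (hσ : 1 / 2 < σ) (hτ : 0 < τ.re) (hx : 0 < x) :
    psiC (τ * x) = mellinInv σ (fun w => τ ^ (-w) * completedRiemannZeta (2 * w)) x := by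
  have hσ0 : 0 < σ := by linarith
  have hG := verticalIntegrable_Gamma_mul_cpow hσ0 hτ
  let F (n : ℕ) (y : ℝ) : ℂ := (((π * ((n : ℝ) + 1) ^ 2) * x : ℝ) : ℂ) ^ (-(σ + y * I : ℂ)) *
    (τ ^ (-(σ + y * I : ℂ)) * Complex.Gamma (σ + y * I))
  have hpos (n : ℕ) : 0 < (π * ((n : ℝ) + 1) ^ 2) * x := by positivity
  have hnorm (n : ℕ) (y : ℝ) : ‖F n y‖ = (π * ((n : ℝ) + 1) ^ 2) ^ (-σ) *
      (x ^ (-σ) * ‖τ ^ (-(σ + y * I : ℂ)) * Complex.Gamma (σ + y * I)‖) := by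
    rw [norm_mul, norm_cpow_eq_rpow_re_of_pos (hpos n), ← mul_assoc,
      ← Real.mul_rpow (by positivity) hx.le]
    simp
  have hF (n : ℕ) : Integrable (F n) := by
    refine (((Integrable.norm hG).const_mul (x ^ (-σ))).const_mul
      ((π * ((n : ℝ) + 1) ^ 2) ^ (-σ))).mono' ?_
      (Filter.Eventually.of_forall fun y => (hnorm n y).le)
    refine AEStronglyMeasurable.mul ?_ (Integrable.aestronglyMeasurable hG)
    exact Measurable.aestronglyMeasurable (by fun_prop)
  have hsum : Summable fun n => ∫ y, ‖F n y‖ := by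
    simp_rw [hnorm, integral_const_mul]
    exact (summable_pi_mul_sq_rpow hσ).mul_right _
  have hterm (n : ℕ) : cexp (-(π : ℂ) * ((n : ℂ) + 1) ^ 2 * (τ * x)) =
      (1 / (2 * π)) • ∫ y, F n y := by
    have h := mellinInv_cpow_neg_mul_Gamma hσ0 hτ (hpos n)
    simp only [mellinInv, smul_eq_mul] at h
    rw [h]
    push_cast
    ring_nf
  have htsum (y : ℝ) : ∑' n, F n y = (x : ℂ) ^ (-(σ + y * I : ℂ)) •
      (τ ^ (-(σ + y * I : ℂ)) * completedRiemannZeta (2 * (σ + y * I))) := by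
    rw [completedRiemannZeta_eq_Gamma_mul_tsum (by simpa using hσ), ← mul_assoc, smul_eq_mul,
      ← tsum_mul_left, ← tsum_mul_left]
    refine tsum_congr fun n => ?_
    simp only [F]
    rw [ofReal_mul, mul_cpow_ofReal_nonneg (by positivity) hx.le]
    ring
  simp only [psiC, mellinInv, hterm, ← htsum]
  exact ((hasSum_integral_of_summable_integral_norm hF hsum).const_smul (1 / (2 * π))).tsum_eq

theorem vertical_line_integral_expression (τ s : ℂ) (hτ : 0 < τ.re) (hs0 : s ≠ 0)
    (c : ℝ) (hc : max s.re 1 < c) :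
    τ ^ (s / 2) * ∫ x in Set.Ioi (1 : ℝ), (x : ℂ) ^ (s / 2 - 1) * psiC (τ * x) =
      (τ ^ (s / 2) / (2 * (π : ℂ))) *
        ∫ t : ℝ,
          completedRiemannZeta ((c : ℂ) + t * Complex.I) *
              τ ^ (-((c : ℂ) + t * Complex.I) / 2) / ((c : ℂ) + t * Complex.I - s) := by
  have hσ : 1 / 2 < c / 2 := by linarith [le_max_right s.re 1]
  have hs : (s / 2).re < c / 2 := by
    rw [div_ofNat_re]
    linarith [le_max_left s.re 1]
  have hpsi : ∫ x in Set.Ioi (1 : ℝ), (x : ℂ) ^ (s / 2 - 1) * psiC (τ * x) =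
      ∫ x in Set.Ioi (1 : ℝ), (x : ℂ) ^ (s / 2 - 1) *
        mellinInv (c / 2) (fun w => τ ^ (-w) * completedRiemannZeta (2 * w)) x :=
    setIntegral_congr_fun measurableSet_Ioi fun x hx => by
      simp only [psiC_mul_eq_mellinInv hσ hτ (one_pos.trans hx)]
  rw [hpsi, integral_Ioi_one_cpow_mul_mellinInv hs
    (verticalIntegrable_cpow_mul_completedRiemannZeta hσ hτ), ← mul_assoc, mul_one_div]
  congr 1
  let g (t : ℝ) : ℂ := completedRiemannZeta ((c : ℂ) + t * Complex.I) *
    τ ^ (-((c : ℂ) + t * Complex.I) / 2) / ((c : ℂ) + t * Complex.I - s)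
  have hg (y : ℝ) : τ ^ (-(((c / 2 : ℝ) : ℂ) + y * I)) *
      completedRiemannZeta (2 * (((c / 2 : ℝ) : ℂ) + y * I)) / (((c / 2 : ℝ) : ℂ) + y * I - s / 2) =
      2 * g (2 * y) := by
    have h1 : (2 * (((c / 2 : ℝ) : ℂ) + y * I)) = c + (2 * y : ℝ) * I := by push_cast; ring
    have h2 : -(((c / 2 : ℝ) : ℂ) + y * I) = -(c + (2 * y : ℝ) * I) / 2 := by push_cast; ring
    have h3 : ((c / 2 : ℝ) : ℂ) + y * I - s / 2 = (c + (2 * y : ℝ) * I - s) / 2 := by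
      push_cast; ring
    simp only [g]
    rw [h1, h2, h3, div_div_eq_mul_div]
    ring
  simp_rw [hg]
  rw [integral_const_mul, Measure.integral_comp_mul_left g 2, abs_of_pos (by norm_num), real_smul,
    ← mul_assoc]
  simp [g]
end

section
/- The entire function G(s) := -1 + s·∫_{1}^{∞} x^{s/2 - 1}·ψ(x) dx has infinitely many zeros; that is, the set {s ∈ ℂ : G(s) = 0} is infinite. -/
open MeasureTheory Complex Real

/-- For real `x ≥ 1`, `ψ x = ∑_{n ≥ 1} exp (-π n² x)`. -/
noncomputable def psiR (x : ℝ) : ℝ := ∑' n : ℕ, Real.exp (-π * ((n : ℝ) + 1) ^ 2 * x)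

/-- A nowhere vanishing entire function is the exponential of an entire function. -/
theorem exists_entire_exp_eq {g : ℂ → ℂ} (hg : Differentiable ℂ g) (hg0 : ∀ z, g z ≠ 0) :
    ∃ h : ℂ → ℂ, Differentiable ℂ h ∧ ∀ z, Complex.exp (h z) = g z := by
  have hsc : IsSimplyConnected (Set.univ : Set ℂ) := by
    have := (convex_univ (𝕜 := ℝ) (E := ℂ)).contractibleSpace Set.univ_nonempty
    exact (inferInstance : SimplyConnectedSpace (Set.univ : Set ℂ))
  obtain ⟨h, hc, he⟩ := exists_continuousOn_eqOn_exp_comp hsc isOpen_univ hg.continuous.continuousOn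
    (by simpa using hg0)
  have hE : ∀ z, Complex.exp (h z) = g z := fun z => he (Set.mem_univ z)
  have hc : Continuous h := by simpa using hc
  refine ⟨h, fun z₀ => ?_, hE⟩
  have hev : h =ᶠ[nhds z₀] fun z => h z₀ + Complex.log (g z / g z₀) := by
    have : ∀ᶠ z in nhds z₀, ‖h z - h z₀‖ < π := by
      have h1 : Continuous fun z => ‖h z - h z₀‖ := by fun_prop
      exact h1.continuousAt.eventually_lt continuousAt_const (by simpa using Real.pi_pos)
    filter_upwards [this] with z hz
    have him := (Complex.abs_im_le_norm (h z - h z₀)).trans_lt hz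
    rw [← hE z, ← hE z₀, ← Complex.exp_sub, Complex.log_exp (by linarith [(abs_lt.mp him).1])
      (abs_lt.mp him).2.le]
    ring
  refine DifferentiableAt.congr_of_eventuallyEq ?_ hev
  refine (((hg z₀).div_const _).clog ?_).const_add _
  rw [div_self (hg0 z₀)]
  exact Complex.one_mem_slitPlane

/-- An entire function whose real part is `O(|z|^(3/2))` from above is affine. -/
theorem entire_affine_of_re_le {h : ℂ → ℂ} (hh : Differentiable ℂ h) {C : ℝ}
    (hre : ∀ z, (h z).re ≤ C * ((1 + ‖z‖) * √(1 + ‖z‖))) :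
    ∃ a b : ℂ, ∀ z, h z = a * z + b := by
  wlog hC : 0 < C generalizing C
  · exact this (C := 1) (fun z => (hre z).trans (by gcongr; linarith)) one_pos
  have hball : ∀ R : ℝ, 1 ≤ R → ∀ z, ‖z‖ ≤ 2 * R → ‖h z‖ ≤ (50 * C + 3 * ‖h 0‖) * (R * √R) := by
    intro R hR z hz
    have hM : Set.MapsTo h (Metric.ball 0 (4 * R)) {z | z.re ≤ C * ((5 * R) * √(5 * R))} := by
      intro w hw
      have hw : ‖w‖ < 4 * R := by simpa using hw
      refine (hre w).trans ?_
      have : 1 + ‖w‖ ≤ 5 * R := by linarith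
      gcongr
    have hb := Complex.borelCaratheodory (by positivity) hh.differentiableOn hM (by linarith)
      (z := z) (by simp; linarith)
    have h1 : 2 * (C * ((5 * R) * √(5 * R))) * ‖z‖ / (4 * R - ‖z‖)
        ≤ 2 * (C * ((5 * R) * √(5 * R))) := by
      rw [div_le_iff₀ (by linarith)]
      gcongr
      linarith
    have h2 : ‖h 0‖ * (4 * R + ‖z‖) / (4 * R - ‖z‖) ≤ 3 * ‖h 0‖ := by
      rw [div_le_iff₀ (by linarith)]
      nlinarith [norm_nonneg (h 0)]
    have h3 : √(5 * R) ≤ 5 * √R := by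
      rw [Real.sqrt_le_left (by positivity), mul_pow, Real.sq_sqrt (by linarith)]
      linarith
    have h4 : 1 ≤ R * √R := one_le_mul_of_one_le_of_one_le hR (Real.one_le_sqrt.mpr hR)
    calc ‖h z‖ ≤ 2 * (C * ((5 * R) * √(5 * R))) + 3 * ‖h 0‖ := by linarith
      _ ≤ 2 * (C * ((5 * R) * (5 * √R))) + 3 * ‖h 0‖ * (R * √R) := by
        gcongr 2 * (C * (5 * R * ?_)) + ?_
        exact le_mul_of_one_le_right (by positivity) h4
      _ = _ := by ring
  have hd2 : ∀ c, iteratedDeriv 2 h c = 0 := by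
    intro c
    set K := 50 * C + 3 * ‖h 0‖ with hK
    have hle : ∀ᶠ R : ℝ in Filter.atTop, ‖iteratedDeriv 2 h c‖ ≤ 2 * K * (√R)⁻¹ := by
      filter_upwards [Filter.eventually_ge_atTop 1, Filter.eventually_ge_atTop ‖c‖] with R hR hcR
      have := Complex.norm_iteratedDeriv_le_of_forall_mem_sphere_norm_le (c := c) (R := R)
        (C := K * (R * √R)) 2 (by linarith) hh.diffContOnCl (fun z hz => hball R hR z (by
          have h1 : ‖z - c‖ = R := by simpa [dist_eq_norm] using hz
          have := norm_add_le (z - c) c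
          rw [sub_add_cancel] at this
          linarith))
      refine this.trans (le_of_eq ?_)
      have hR0 : 0 < R := by linarith
      have hs : 0 < √R := Real.sqrt_pos.mpr hR0
      have hs2 := Real.sq_sqrt hR0.le
      simp only [Nat.factorial]
      field_simp
      push_cast
      linear_combination 2 * K * hs2
    have hlim : Filter.Tendsto (fun R : ℝ => 2 * K * (√R)⁻¹) Filter.atTop (nhds 0) := by
      simpa using (Real.tendsto_sqrt_atTop.inv_tendsto_atTop).const_mul (2 * K)
    exact norm_le_zero_iff.mp (ge_of_tendsto hlim hle)
  have hd : Differentiable ℂ (deriv h) := fun z => (hh.analyticAt z).deriv.differentiableAt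
  have hconst : ∀ z, deriv h z = deriv h 0 := fun z =>
    is_const_of_deriv_eq_zero hd (fun x => by simpa [iteratedDeriv_succ] using hd2 x) z 0
  refine ⟨deriv h 0, h 0, fun z => ?_⟩
  have hk : Differentiable ℂ fun z => h z - deriv h 0 * z := by fun_prop
  have := is_const_of_deriv_eq_zero hk (fun x => by
    rw [deriv_fun_sub (hh x) (by fun_prop), hconst x]
    simp) z 0
  simp only [mul_zero, sub_zero] at this
  linear_combination this

/-- An entire function of order at most `3/2` with finitely many zeros has exponential type. -/
theorem exists_norm_le_exp_of_finite_zeros (S : Finset ℂ) :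
    ∀ {F : ℂ → ℂ}, Differentiable ℂ F → (∃ z, F z ≠ 0) → (∀ z, F z = 0 → z ∈ S) →
    (∃ C, ∀ z, ‖F z‖ ≤ Real.exp (C * ((1 + ‖z‖) * √(1 + ‖z‖)))) →
    ∃ K, ∀ z, ‖F z‖ ≤ Real.exp (K * (1 + ‖z‖)) := by
  induction S using Finset.induction_on with
  | empty =>
    rintro F hF - hz ⟨C, hC⟩
    obtain ⟨h, hh, he⟩ := exists_entire_exp_eq hF (fun z hz0 => by simpa using hz z hz0)
    obtain ⟨a, b, hab⟩ := entire_affine_of_re_le hh (C := C) (fun z => by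
      have := hC z
      rwa [← he, Complex.norm_exp, Real.exp_le_exp] at this)
    refine ⟨‖a‖ + ‖b‖, fun z => ?_⟩
    rw [← he, Complex.norm_exp, Real.exp_le_exp, hab]
    calc (a * z + b).re ≤ ‖a * z + b‖ := Complex.re_le_norm _
      _ ≤ ‖a‖ * ‖z‖ + ‖b‖ := (norm_add_le _ _).trans (by rw [norm_mul])
      _ ≤ _ := by nlinarith [norm_nonneg a, norm_nonneg b, norm_nonneg z]
  | insert c S _ ih =>
    rintro F hF ⟨w, hw⟩ hz ⟨C, hC⟩
    obtain ⟨p, hp⟩ := hF.analyticAt c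
    have hp0 : p ≠ 0 := by
      intro h0
      have h1 := hp.locally_zero_iff.mpr h0
      have h2 : AnalyticOnNhd ℂ F Set.univ := fun z _ => hF.analyticAt z
      exact hw (h2.eqOn_zero_of_preconnected_of_eventuallyEq_zero isPreconnected_univ
        (Set.mem_univ c) h1 (Set.mem_univ w))
    set g := (Function.swap dslope c)^[p.order] F with hgdef
    have hFg : ∀ z, F z = (z - c) ^ p.order * g z := fun z => hp.eq_pow_order_mul_iterate_dslope z
    have hgc : g c ≠ 0 := hp.iterate_dslope_fslope_ne_zero hp0
    have hg : Differentiable ℂ g := by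
      have : ∀ n, Differentiable ℂ ((Function.swap dslope c)^[n] F) := by
        intro n
        induction n with
        | zero => exact hF
        | succ n ihn =>
          rw [Function.iterate_succ_apply', ← differentiableOn_univ]
          exact (Complex.differentiableOn_dslope Filter.univ_mem).mpr ihn.differentiableOn
      exact this _
    obtain ⟨B, hB⟩ := (isCompact_closedBall c 1).exists_bound_of_continuousOn
      hg.continuous.continuousOn
    obtain ⟨K, hK⟩ := ih hg ⟨c, hgc⟩ (fun z hgz => by
      have h1 := hz z (by rw [hFg, hgz, mul_zero])
      rcases Finset.mem_insert.mp h1 with rfl | h1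
      · exact absurd hgz hgc
      · exact h1) ⟨|C| + |B|, fun z => by
        have hy : 1 ≤ (1 + ‖z‖) * √(1 + ‖z‖) := by
          have : 1 ≤ 1 + ‖z‖ := by linarith [norm_nonneg z]
          exact one_le_mul_of_one_le_of_one_le this (Real.one_le_sqrt.mpr this)
        by_cases hzc : ‖z - c‖ ≤ 1
        · refine (hB z (by simpa [dist_eq_norm] using hzc)).trans ?_
          have h1 := Real.add_one_le_exp B
          refine (show B ≤ Real.exp B by linarith).trans (Real.exp_le_exp.mpr ?_)
          nlinarith [le_abs_self B, abs_nonneg B, abs_nonneg C]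
        · have h1 : ‖g z‖ ≤ ‖F z‖ := by
            rw [hFg, norm_mul, norm_pow]
            exact le_mul_of_one_le_left (norm_nonneg _) (one_le_pow₀ (not_le.mp hzc).le)
          refine h1.trans ((hC z).trans (Real.exp_le_exp.mpr ?_))
          gcongr
          linarith [le_abs_self C, abs_nonneg B]⟩
    refine ⟨p.order * (1 + ‖c‖) + K, fun z => ?_⟩
    have h1 : ‖z - c‖ ≤ Real.exp ((1 + ‖c‖) * (1 + ‖z‖)) := by
      have h2 := Real.add_one_le_exp ((1 + ‖c‖) * (1 + ‖z‖))
      have h3 := norm_sub_le z c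
      nlinarith [norm_nonneg z, norm_nonneg c]
    rw [hFg, norm_mul, norm_pow, add_mul, Real.exp_add, mul_assoc, Real.exp_nat_mul]
    gcongr
    exact hK z

theorem psiR_term_le {x : ℝ} (hx : 1 ≤ x) (n : ℕ) :
    Real.exp (-π * ((n : ℝ) + 1) ^ 2 * x) ≤ Real.exp (-n) * Real.exp (-x) := by
  rw [← Real.exp_add, Real.exp_le_exp]
  have hn : (0 : ℝ) ≤ n := Nat.cast_nonneg n
  have h1 : (n : ℝ) + x ≤ ((n : ℝ) + 1) ^ 2 * x := by nlinarith [mul_nonneg hn hn]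
  nlinarith [Real.pi_gt_three]

theorem summable_psiR {x : ℝ} (hx : 1 ≤ x) :
    Summable fun n : ℕ => Real.exp (-π * ((n : ℝ) + 1) ^ 2 * x) :=
  Summable.of_nonneg_of_le (fun _ => (Real.exp_pos _).le) (psiR_term_le hx)
    (Real.summable_exp_neg_nat.mul_right _)

theorem psiR_le {x : ℝ} (hx : 1 ≤ x) :
    psiR x ≤ (∑' n : ℕ, Real.exp (-n)) * Real.exp (-x) := by
  rw [← tsum_mul_right]
  exact (summable_psiR hx).tsum_le_tsum (psiR_term_le hx) (Real.summable_exp_neg_nat.mul_right _)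

theorem psiR_nonneg (x : ℝ) : 0 ≤ psiR x := tsum_nonneg fun _ => (Real.exp_pos _).le

theorem exp_le_psiR {x : ℝ} (hx : 1 ≤ x) : Real.exp (-π * x) ≤ psiR x := by
  simpa [psiR] using (summable_psiR hx).le_tsum 0 fun _ _ => (Real.exp_pos _).le

theorem measurable_psiR : Measurable psiR := by
  unfold psiR
  exact Measurable.tsum fun n => by fun_prop

theorem integrableOn_pow_mul_exp_neg (n : ℕ) :
    IntegrableOn (fun x : ℝ => x ^ n * Real.exp (-x)) (Set.Ioi 0) := by
  refine (Real.GammaIntegral_convergent (s := n + 1) (by positivity)).congr_fun (fun x _ => ?_)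
    measurableSet_Ioi
  simp [mul_comm]

theorem integral_pow_mul_exp_neg_le (n : ℕ) :
    ∫ x in Set.Ioi (1 : ℝ), x ^ n * Real.exp (-x) ≤ n.factorial := by
  rw [← Real.Gamma_nat_eq_factorial, Real.Gamma_eq_integral (by positivity)]
  calc _ ≤ ∫ x in Set.Ioi (0 : ℝ), x ^ n * Real.exp (-x) := by
        refine setIntegral_mono_set (integrableOn_pow_mul_exp_neg n) ?_
          (Set.Ioi_subset_Ioi zero_le_one).eventuallyLE
        filter_upwards [ae_restrict_mem measurableSet_Ioi] with x hx
        have : 0 < x := hx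
        simp only [Pi.zero_apply]
        positivity
    _ = _ := by simp [mul_comm]

theorem norm_cpow_mul_psiR_le {s : ℂ} {n : ℕ} (hn : ‖s‖ ≤ n) {x : ℝ} (hx : 1 < x) :
    ‖(x : ℂ) ^ (s / 2 - 1) * (psiR x : ℂ)‖ ≤
      (∑' n : ℕ, Real.exp (-n)) * (x ^ n * Real.exp (-x)) := by
  rw [norm_mul, Complex.norm_cpow_eq_rpow_re_of_pos (by linarith), Complex.norm_real,
    Real.norm_of_nonneg (psiR_nonneg x)]
  have h1 : x ^ (s / 2 - 1).re ≤ x ^ n := by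
    rw [← Real.rpow_natCast]
    refine Real.rpow_le_rpow_of_exponent_le hx.le ?_
    have := Complex.re_le_norm s
    have := norm_nonneg s
    simp
    linarith
  calc _ ≤ x ^ n * ((∑' n : ℕ, Real.exp (-n)) * Real.exp (-x)) :=
        mul_le_mul h1 (psiR_le hx.le) (psiR_nonneg x) (by positivity)
    _ = _ := by ring

theorem aestronglyMeasurable_cpow_mul_psiR (s : ℂ) :
    AEStronglyMeasurable (fun x : ℝ => (x : ℂ) ^ (s / 2 - 1) * (psiR x : ℂ))
      (volume.restrict (Set.Ioi 1)) := by
  refine Measurable.aestronglyMeasurable ?_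
  exact (Complex.measurable_ofReal.pow_const _).mul (Complex.measurable_ofReal.comp measurable_psiR)

theorem integrableOn_cpow_mul_psiR (s : ℂ) :
    IntegrableOn (fun x : ℝ => (x : ℂ) ^ (s / 2 - 1) * (psiR x : ℂ)) (Set.Ioi 1) := by
  obtain ⟨n, hn⟩ := exists_nat_ge ‖s‖
  refine Integrable.mono' (((integrableOn_pow_mul_exp_neg n).mono_set
    (Set.Ioi_subset_Ioi zero_le_one)).const_mul (∑' n : ℕ, Real.exp (-n)))
    (aestronglyMeasurable_cpow_mul_psiR s) ?_
  filter_upwards [ae_restrict_mem measurableSet_Ioi] with x hx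
  exact norm_cpow_mul_psiR_le hn hx

theorem norm_integral_cpow_mul_psiR_le {s : ℂ} {n : ℕ} (hn : ‖s‖ ≤ n) :
    ‖∫ x in Set.Ioi (1 : ℝ), (x : ℂ) ^ (s / 2 - 1) * (psiR x : ℂ)‖ ≤
      (∑' n : ℕ, Real.exp (-n)) * n.factorial := by
  refine (norm_integral_le_of_norm_le (((integrableOn_pow_mul_exp_neg n).mono_set
    (Set.Ioi_subset_Ioi zero_le_one)).const_mul (∑' n : ℕ, Real.exp (-n))) ?_).trans ?_
  · filter_upwards [ae_restrict_mem measurableSet_Ioi] with x hx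
    exact norm_cpow_mul_psiR_le hn hx
  · rw [integral_const_mul]
    exact mul_le_mul_of_nonneg_left (integral_pow_mul_exp_neg_le n)
      (tsum_nonneg fun _ => (Real.exp_pos _).le)

theorem differentiable_integral_cpow_mul_psiR :
    Differentiable ℂ fun s : ℂ =>
      ∫ x in Set.Ioi (1 : ℝ), (x : ℂ) ^ (s / 2 - 1) * (psiR x : ℂ) := by
  set f : ℝ → ℂ := (Set.Ioi 1).indicator fun x => (psiR x : ℂ) with hf
  have hmellin : (fun s : ℂ => ∫ x in Set.Ioi (1 : ℝ), (x : ℂ) ^ (s / 2 - 1) * (psiR x : ℂ)) =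
      fun s => mellin f (s / 2) := by
    funext s
    have h1 : ∀ x : ℝ, (x : ℂ) ^ (s / 2 - 1) • f x =
        (Set.Ioi 1).indicator (fun x : ℝ => (x : ℂ) ^ (s / 2 - 1) * (psiR x : ℂ)) x := by
      intro x
      by_cases hx : x ∈ Set.Ioi (1 : ℝ) <;> simp [hf, hx]
    simp only [mellin, h1]
    rw [setIntegral_indicator measurableSet_Ioi,
      Set.inter_eq_right.mpr (Set.Ioi_subset_Ioi zero_le_one)]
  have hint : Integrable f := by
    rw [hf, integrable_indicator_iff measurableSet_Ioi]
    simpa using integrableOn_cpow_mul_psiR 2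
  have htop : f =O[Filter.atTop] fun t => Real.exp (-1 * t) := by
    refine Asymptotics.IsBigO.of_bound (∑' n : ℕ, Real.exp (-n)) ?_
    filter_upwards [Filter.eventually_gt_atTop 1] with x hx
    rw [hf, Set.indicator_of_mem (show x ∈ Set.Ioi 1 from hx), Complex.norm_real,
      Real.norm_of_nonneg (psiR_nonneg x), Real.norm_of_nonneg (Real.exp_pos _).le]
    simpa using psiR_le hx.le
  have hbot : ∀ b : ℝ, f =O[nhdsWithin 0 (Set.Ioi 0)] fun x => x ^ (-b) := by
    intro b
    refine Asymptotics.IsBigO.of_bound 1 ?_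
    filter_upwards [nhdsWithin_le_nhds (Iio_mem_nhds zero_lt_one)] with x hx
    rw [hf, Set.indicator_of_notMem (by simpa using le_of_lt hx)]
    simp
  rw [hmellin]
  intro s
  have := mellin_differentiableAt_of_isBigO_rpow_exp (s := s / 2) one_pos
    (hint.locallyIntegrable.locallyIntegrableOn _) htop (hbot _) (sub_one_lt _)
  exact DifferentiableAt.comp (g := mellin f) s this (differentiableAt_id.div_const 2)

theorem norm_G_le (s : ℂ) :
    ‖-1 + s * ∫ x in Set.Ioi (1 : ℝ), (x : ℂ) ^ (s / 2 - 1) * (psiR x : ℂ)‖ ≤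
      Real.exp ((2 + ∑' n : ℕ, Real.exp (-n)) * ((1 + ‖s‖) * √(1 + ‖s‖))) := by
  set S := ∑' n : ℕ, Real.exp (-n)
  have hS : 0 ≤ S := tsum_nonneg fun _ => (Real.exp_pos _).le
  set y := 1 + ‖s‖ with hy
  have hy1 : 1 ≤ y := by linarith [norm_nonneg s]
  have hsy : 1 ≤ √y := Real.one_le_sqrt.mpr hy1
  set n := ⌈‖s‖⌉₊
  have hn : ‖s‖ ≤ n := Nat.le_ceil _
  have hny : (n : ℝ) ≤ y := by linarith [Nat.ceil_lt_add_one (norm_nonneg s)]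
  have hexp : y ≤ Real.exp (2 * √y) := by
    have h1 : √y ≤ Real.exp √y := by linarith [Real.add_one_le_exp √y]
    calc y = √y ^ 2 := (Real.sq_sqrt (by linarith)).symm
      _ ≤ Real.exp √y ^ 2 := by gcongr
      _ = _ := by rw [← Real.exp_nat_mul]; simp
  have hfac : (n.factorial : ℝ) ≤ Real.exp (2 * (y * √y)) := by
    calc (n.factorial : ℝ) ≤ (n : ℝ) ^ n := by exact_mod_cast Nat.factorial_le_pow n
      _ ≤ Real.exp (2 * √y) ^ n := by gcongr; exact hny.trans hexp
      _ = Real.exp (n * (2 * √y)) := (Real.exp_nat_mul _ _).symm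
      _ ≤ _ := by
        rw [Real.exp_le_exp]
        nlinarith
  have hY : y ≤ y * √y := le_mul_of_one_le_right (by linarith) hsy
  have hE : 1 ≤ Real.exp (2 * (y * √y)) := Real.one_le_exp (by positivity)
  calc _ ≤ 1 + ‖s‖ * (S * n.factorial) := by
        refine (norm_add_le _ _).trans ?_
        rw [norm_neg, norm_one, norm_mul]
        gcongr
        exact norm_integral_cpow_mul_psiR_le hn
    _ ≤ Real.exp (2 * (y * √y)) + y * √y * (S * Real.exp (2 * (y * √y))) := by
        gcongr
        linarith
    _ = Real.exp (2 * (y * √y)) * (S * (y * √y) + 1) := by ring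
    _ ≤ Real.exp (2 * (y * √y)) * Real.exp (S * (y * √y)) := by
        gcongr
        exact Real.add_one_le_exp _
    _ = _ := by rw [← Real.exp_add]; ring_nf

theorem le_norm_integral_cpow_mul_psiR {A r : ℝ} (hA : 1 ≤ A) (hr : 2 ≤ r) :
    A ^ (r / 2 - 1) * Real.exp (-π * (A + 1)) ≤
      ‖∫ x in Set.Ioi (1 : ℝ), (x : ℂ) ^ ((r : ℂ) / 2 - 1) * (psiR x : ℂ)‖ := by
  have hcast : ∀ x ∈ Set.Ioi (1 : ℝ), (x : ℂ) ^ ((r : ℂ) / 2 - 1) * (psiR x : ℂ) =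
      ((x ^ (r / 2 - 1) * psiR x : ℝ) : ℂ) := by
    intro x hx
    have hx0 : (0 : ℝ) ≤ x := by linarith [show 1 < x from hx]
    rw [Complex.ofReal_mul, Complex.ofReal_cpow hx0]
    push_cast
    rfl
  have hint : IntegrableOn (fun x : ℝ => x ^ (r / 2 - 1) * psiR x) (Set.Ioi 1) := by
    have := ((integrableOn_cpow_mul_psiR r).congr_fun hcast measurableSet_Ioi).re
    simpa [IntegrableOn] using this
  rw [setIntegral_congr_fun measurableSet_Ioi hcast, integral_complex_ofReal, Complex.norm_real]
  refine le_trans ?_ (le_abs_self _)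
  calc A ^ (r / 2 - 1) * Real.exp (-π * (A + 1))
      = ∫ _ in Set.Ioc A (A + 1), A ^ (r / 2 - 1) * Real.exp (-π * (A + 1)) := by simp
    _ ≤ ∫ x in Set.Ioc A (A + 1), x ^ (r / 2 - 1) * psiR x := by
        refine setIntegral_mono_on (integrableOn_const (by simp)) (hint.mono_set fun x hx =>
          lt_of_le_of_lt hA hx.1) measurableSet_Ioc fun x hx => ?_
        have hx1 : 1 ≤ x := hA.trans hx.1.le
        have h1 : Real.exp (-π * (A + 1)) ≤ psiR x := by
          refine le_trans (Real.exp_le_exp.mpr ?_) (exp_le_psiR hx1)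
          nlinarith [Real.pi_pos, hx.2]
        have h2 : A ^ (r / 2 - 1) ≤ x ^ (r / 2 - 1) :=
          Real.rpow_le_rpow (by linarith) hx.1.le (by linarith)
        gcongr
    _ ≤ _ := by
        refine setIntegral_mono_set hint ?_
          (Filter.Eventually.of_forall fun x hx => lt_of_le_of_lt hA hx.1)
        filter_upwards [ae_restrict_mem measurableSet_Ioi] with x hx
        have hx0 : (0 : ℝ) ≤ x := by linarith [show 1 < x from hx]
        exact mul_nonneg (Real.rpow_nonneg hx0 _) (psiR_nonneg x)

theorem G_infinitely_many_zeros :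
    {s : ℂ |
        -1 + s * (∫ x in Set.Ioi (1 : ℝ), (x : ℂ) ^ (s / 2 - 1) * (psiR x : ℂ)) = 0}.Infinite := by
  intro hfin
  obtain ⟨K₀, hK₀⟩ := exists_norm_le_exp_of_finite_zeros hfin.toFinset
    (F := fun s => -1 + s * ∫ x in Set.Ioi (1 : ℝ), (x : ℂ) ^ (s / 2 - 1) * (psiR x : ℂ))
    ((differentiable_id.mul differentiable_integral_cpow_mul_psiR).const_add _)
    ⟨0, by simp⟩ (fun z hz => by simpa using hz) ⟨_, norm_G_le⟩
  set K := |K₀|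
  have hK : 0 ≤ K := abs_nonneg _
  set A := Real.exp (2 * (K + 1)) with hA
  have hA1 : 1 ≤ A := Real.one_le_exp (by positivity)
  set c := Real.exp (-(2 * (K + 1))) * Real.exp (-π * (A + 1)) with hc
  have hc0 : 0 < c := by positivity
  have hbound : ∀ r : ℝ, 2 ≤ r → r * c ≤ Real.exp K + 1 := by
    intro r hr
    have h1 := le_norm_integral_cpow_mul_psiR hA1 hr
    set I := ∫ x in Set.Ioi (1 : ℝ), (x : ℂ) ^ ((r : ℂ) / 2 - 1) * (psiR x : ℂ)
    have hAr : A ^ (r / 2 - 1) = Real.exp ((K + 1) * r) * Real.exp (-(2 * (K + 1))) := by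
      rw [hA, ← Real.exp_mul, ← Real.exp_add]
      ring_nf
    rw [hAr, mul_assoc, ← hc] at h1
    have h2 : r * ‖I‖ ≤ ‖-1 + (r : ℂ) * I‖ + 1 := by
      have := norm_sub_le (-1 + (r : ℂ) * I) (-1)
      rw [show (-1 + (r : ℂ) * I) - (-1) = r * I by ring, norm_mul, Complex.norm_real,
        Real.norm_of_nonneg (by linarith), norm_neg, norm_one] at this
      exact this
    have h3 : ‖-1 + (r : ℂ) * I‖ ≤ Real.exp (K₀ * (1 + r)) := by
      have := hK₀ r
      rwa [Complex.norm_real, Real.norm_of_nonneg (by linarith)] at this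
    have h4 : Real.exp (K₀ * (1 + r)) ≤ Real.exp K * Real.exp ((K + 1) * r) := by
      rw [← Real.exp_add, Real.exp_le_exp]
      nlinarith [le_abs_self K₀]
    have h5 : 1 ≤ Real.exp ((K + 1) * r) := Real.one_le_exp (by positivity)
    have h6 : 0 < Real.exp ((K + 1) * r) := Real.exp_pos _
    have h7 : r * (Real.exp ((K + 1) * r) * c) ≤ r * ‖I‖ := by gcongr
    refine le_of_mul_le_mul_left ?_ h6
    nlinarith
  have h1 := hbound (2 + (Real.exp K + 1) / c) (by have := Real.exp_pos K; simp; positivity)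
  rw [add_mul, div_mul_cancel₀ _ hc0.ne'] at h1
  linarith
end
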